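/- Let q ∈ (2,∞) and p ∈ (1,∞) with p > q/2. There is a constant C, independent of T, such that for every T > 0 and every u ∈ L^q((0,T); Ḣ^{1/2 + 2/q}): ( ∫₀^T ‖𝓑(u,u)(t)‖_{Ḣ^{1/2+2/p}}^p dt )^{1/p} ≤ C ( ∫₀^T ‖u(s)‖_{Ḣ^{1/2+2/q}}^q ds )^{2/q}, where 𝓑(u,u)(t) = ∫₀^t e^{(t−s)Δ} Q(u,u)(s) ds. -/

import Mathlib

noncomputable section

open MeasureTheory Set Filter
open scoped ENNReal Topology

/-- Frequency space ℝ³ (as functions `Fin 3 → ℝ`, with the product Lebesgue measure). -/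
abbrev V3 : Type := Fin 3 → ℝ

/-- The Euclidean norm on `V3`. -/
def en (ξ : V3) : ℝ := Real.sqrt (∑ i, ξ i ^ 2)

/-- Squared Euclidean magnitude of a vector in ℂ³. -/
def vnSq (v : Fin 3 → ℂ) : ℝ := ∑ j, ‖v j‖ ^ 2

/-- Weighted L²-norm in the frequency variable, valued in `ℝ≥0∞`:
`wnorm w f = ( ∫ (w ξ)² |f ξ|² dξ )^{1/2}`. -/
def wnorm (w : V3 → ℝ) (f : V3 → Fin 3 → ℂ) : ℝ≥0∞ :=
  (∫⁻ ξ : V3, ENNReal.ofReal (w ξ ^ 2 * vnSq (f ξ))) ^ ((1 : ℝ) / 2)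

/-- Weight of the inhomogeneous Sobolev norm `H^γ`, i.e. `⟨ξ⟩^γ`. -/
def wH (γ : ℝ) : V3 → ℝ := fun ξ => (1 + en ξ ^ 2) ^ (γ / 2)

/-- Weight of the homogeneous Sobolev norm `Ḣ^s`, i.e. `|ξ|^s`. -/
def wD (s : ℝ) : V3 → ℝ := fun ξ => en ξ ^ s

/-- Coefficients `α^{j,m,n,p}_{k,ℓ}` of the bilinear form `Q`
(order of arguments: `α j m n p k l`). -/
abbrev Coeffs : Type := Fin 3 → Fin 3 → Fin 3 → Fin 3 → Fin 3 → Fin 3 → ℝ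

/-- The symbol `q^{j,m}_{k,ℓ}(ξ) = Σ_{n,p} α^{j,m,n,p}_{k,ℓ} ξ_n ξ_p / |ξ|²`. -/
def qsym (α : Coeffs) (j m k l : Fin 3) (ξ : V3) : ℝ :=
  ∑ n, ∑ p, α j m n p k l * (ξ n * ξ p) / en ξ ^ 2

/-- Fourier side of the bilinear term `Q(u,v)`: with the convention
`f̂(ξ) = ∫ f(x) e^{-ix·ξ} dx`, the product `u^k v^ℓ` has Fourier transform
`(2π)⁻³ (û^k ∗ v̂^ℓ)(ξ)`, so that
`(Q^j(u,v))^(ξ) = Σ_{k,ℓ,m} q^{j,m}_{k,ℓ}(ξ) · iξ_m · (2π)⁻³ (û^k ∗ v̂^ℓ)(ξ)`. -/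
def Qhat (α : Coeffs) (U W : V3 → Fin 3 → ℂ) : V3 → Fin 3 → ℂ := fun ξ j =>
  ∑ k : Fin 3, ∑ l : Fin 3, ∑ m : Fin 3,
    (qsym α j m k l ξ : ℂ) * (Complex.I * (ξ m : ℂ)) *
      ((((2 * Real.pi) ^ (3 : ℕ))⁻¹ : ℝ) : ℂ) * ∫ η : V3, U η k * W (ξ - η) l

/-- `U` is (the Fourier transform of) a mild solution of the generalized Navier–Stokes
equations on `[0,T]` with (Fourier-side) data `U₀`:
`û(t,ξ) = e^{-t|ξ|²} û₀(ξ) + ∫₀^t e^{-(t-s)|ξ|²} (Q(u,u))^(s,ξ) ds`. -/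
def IsMildSol (α : Coeffs) (U₀ : V3 → Fin 3 → ℂ) (U : ℝ → V3 → Fin 3 → ℂ) (T : ℝ) : Prop :=
  ∀ t ∈ Icc (0 : ℝ) T, ∀ ξ : V3, ∀ j : Fin 3,
    U t ξ j = (Real.exp (-(t * en ξ ^ 2)) : ℂ) * U₀ ξ j
      + ∫ s in (0 : ℝ)..t, (Real.exp (-((t - s) * en ξ ^ 2)) : ℂ) * Qhat α (U s) (U s) ξ j

/-- Continuity on `[0,T]` with values in the weighted L²-space with weight `w`
(this encodes `u ∈ C([0,T]; H)` for the corresponding Sobolev space `H`). -/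
def ContInW (w : V3 → ℝ) (U : ℝ → V3 → Fin 3 → ℂ) (T : ℝ) : Prop :=
  (∀ t ∈ Icc (0 : ℝ) T, wnorm w (U t) < ⊤) ∧
  ∀ t ∈ Icc (0 : ℝ) T, ∀ ε : ℝ≥0∞, 0 < ε → ∃ d > (0 : ℝ), ∀ s ∈ Icc (0 : ℝ) T,
    |s - t| < d → wnorm w (fun ξ j => U s ξ j - U t ξ j) < ε

/-- Membership in `L²((0,T); H)` for the weighted space `H` with weight `w`. -/
def MemL2W (w : V3 → ℝ) (U : ℝ → V3 → Fin 3 → ℂ) (T : ℝ) : Prop :=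
  ∫⁻ t in Ioo (0 : ℝ) T, wnorm w (U t) ^ (2 : ℕ) < ⊤

/-- Joint measurability of a time-dependent (Fourier-side) vector field. -/
def MeasVF (U : ℝ → V3 → Fin 3 → ℂ) : Prop :=
  ∀ j : Fin 3, Measurable (Function.uncurry fun t ξ => U t ξ j)

/-- Divergence-free condition on the Fourier side: `ξ · û₀(ξ) = 0`. -/
def DivFree (U₀ : V3 → Fin 3 → ℂ) : Prop := ∀ ξ : V3, ∑ j : Fin 3, (ξ j : ℂ) * U₀ ξ j = 0

/-- `U₀` is the Fourier transform of a real (ℝ³-valued) vector field. -/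
def RealField (U₀ : V3 → Fin 3 → ℂ) : Prop :=
  ∀ ξ : V3, ∀ j : Fin 3, U₀ (-ξ) j = (starRingEnd ℂ) (U₀ ξ j)

/-- The Duhamel term `𝓑(u,u)(t) = ∫₀^t e^{(t-s)Δ} Q(u,u)(s) ds`, on the Fourier side. -/
def Bhat (α : Coeffs) (Uu Vv : ℝ → V3 → Fin 3 → ℂ) : ℝ → V3 → Fin 3 → ℂ :=
  fun t ξ j =>
    ∫ s in (0 : ℝ)..t, (Real.exp (-((t - s) * en ξ ^ 2)) : ℂ) * Qhat α (Uu s) (Vv s) ξ j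

theorem lintegral_Ioo_rpow {b R : ℝ} (hb : 0 < b) (hR : 0 ≤ R) :
    ∫⁻ x in Ioo 0 R, ENNReal.ofReal x ^ (b - 1) = ENNReal.ofReal (R ^ b / b) := by
  have hi : IntegrableOn (fun x : ℝ => x ^ (b - 1)) (Ioo 0 R) := by
    have := intervalIntegral.intervalIntegrable_rpow' (a := 0) (b := R) (r := b - 1) (by linarith)
    rw [intervalIntegrable_iff_integrableOn_Ioo_of_le hR] at this
    exact this
  have h1 : ∫ x in Ioo 0 R, x ^ (b - 1) = R ^ b / b := by
    rw [← integral_Ioc_eq_integral_Ioo, ← intervalIntegral.integral_of_le hR,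
      integral_rpow (Or.inl (by linarith))]
    simp [Real.zero_rpow hb.ne']
  rw [← h1, ofReal_integral_eq_lintegral_ofReal hi]
  · refine setLIntegral_congr_fun measurableSet_Ioo fun x hx => ?_
    exact ENNReal.ofReal_rpow_of_pos hx.1
  · exact (ae_restrict_mem measurableSet_Ioo).mono fun x hx => Real.rpow_nonneg hx.1.le _

theorem lintegral_Ioi_rpow {a R : ℝ} (ha : a < -1) (hR : 0 < R) :
    ∫⁻ x in Ioi R, ENNReal.ofReal x ^ a = ENNReal.ofReal (-R ^ (a + 1) / (a + 1)) := by
  rw [← integral_Ioi_rpow_of_lt ha hR,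
    ofReal_integral_eq_lintegral_ofReal (integrableOn_Ioi_rpow_of_lt ha hR)]
  · refine setLIntegral_congr_fun measurableSet_Ioi fun x hx => ?_
    exact ENNReal.ofReal_rpow_of_pos (hR.trans hx)
  · exact (ae_restrict_mem measurableSet_Ioi).mono fun x hx => Real.rpow_nonneg (hR.trans hx).le _

/-- The integral of `b x ^ (b - 1)` over `0 < x < X`, for an extended nonnegative `X`. -/
theorem lintegral_rpow_lt {b : ℝ} (hb : 0 < b) (X : ℝ≥0∞) :
    ∫⁻ x in Ioi (0 : ℝ), {x : ℝ | ENNReal.ofReal x < X}.indicator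
      (fun x => ENNReal.ofReal x ^ (b - 1)) x = X ^ b / ENNReal.ofReal b := by
  have key : ∀ R : ℝ, 0 ≤ R →
      ∫⁻ x in Ioi (0 : ℝ), {x : ℝ | ENNReal.ofReal x < ENNReal.ofReal R}.indicator
      (fun x => ENNReal.ofReal x ^ (b - 1)) x = ENNReal.ofReal R ^ b / ENNReal.ofReal b := by
    intro R hR
    have hm : MeasurableSet {x : ℝ | ENNReal.ofReal x < ENNReal.ofReal R} := by measurability
    rw [lintegral_indicator hm, Measure.restrict_restrict hm]
    have : {x : ℝ | ENNReal.ofReal x < ENNReal.ofReal R} ∩ Ioi 0 = Ioo 0 R := by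
      ext x
      simp only [mem_inter_iff, mem_ofPred_eq, mem_Ioi, mem_Ioo]
      constructor
      · rintro ⟨h, h0⟩; exact ⟨h0, (ENNReal.ofReal_lt_ofReal_iff_of_nonneg h0.le).1 h⟩
      · rintro ⟨h, h0⟩; exact ⟨(ENNReal.ofReal_lt_ofReal_iff_of_nonneg h.le).2 h0, h⟩
    rw [this, lintegral_Ioo_rpow hb hR, ENNReal.ofReal_div_of_pos hb,
      ENNReal.ofReal_rpow_of_nonneg hR hb.le]
  rcases eq_or_ne X ⊤ with rfl | hX
  · rw [ENNReal.top_rpow_of_pos hb, ENNReal.top_div_of_ne_top ENNReal.ofReal_ne_top]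
    refine ENNReal.eq_top_of_forall_nnreal_le fun r => ?_
    have := key ((b * r) ^ (1 / b)) (by positivity)
    rw [ENNReal.ofReal_rpow_of_nonneg (by positivity) hb.le, ← Real.rpow_mul (by positivity),
      one_div_mul_cancel hb.ne', Real.rpow_one, ← ENNReal.ofReal_div_of_pos hb,
      mul_div_cancel_left₀ _ hb.ne', ENNReal.ofReal_coe_nnreal] at this
    rw [← this]
    refine lintegral_mono fun x => indicator_le_indicator_of_subset ?_ (fun _ => zero_le) x
    intro x hx
    simp
  · have := key X.toReal ENNReal.toReal_nonneg
    rwa [ENNReal.ofReal_toReal hX] at this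

/-- The kernel `x ^ (-θ)` on the positive half line. -/
def rieszKernel (θ : ℝ) (x : ℝ) : ℝ≥0∞ :=
  (Ioi (0 : ℝ)).indicator (fun x => ENNReal.ofReal x ^ (-θ)) x

theorem measurable_rieszKernel (θ : ℝ) : Measurable (rieszKernel θ) :=
  Measurable.indicator (by fun_prop) measurableSet_Ioi

theorem lintegral_rieszKernel_Iic {κ R : ℝ} (hκ : 0 < κ) (hR : 0 ≤ R) :
    ∫⁻ x, (Iic R).indicator (rieszKernel (1 - κ)) x = ENNReal.ofReal (R ^ κ / κ) := by
  rw [lintegral_indicator measurableSet_Iic]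
  simp only [rieszKernel]
  rw [lintegral_indicator measurableSet_Ioi, Measure.restrict_restrict measurableSet_Ioi,
    Ioi_inter_Iic, setLIntegral_congr Ioo_ae_eq_Ioc.symm, ← lintegral_Ioo_rpow hκ hR]
  simp only [neg_sub]

/-- Hölder bound for the part of the fractional integral far from the singularity. -/
theorem lintegral_rieszKernel_far_le {r p : ℝ} (hr : 1 < r) (hrp : r < p) :
    ∃ A > (0 : ℝ), ∀ g : ℝ → ℝ≥0∞, Measurable g → ∫⁻ s, g s ^ r ≤ 1 → ∀ R > (0 : ℝ), ∀ t,
      ∫⁻ s, (Ioi R).indicator (rieszKernel (1 - (1 / r - 1 / p))) (t - s) * g s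
        ≤ ENNReal.ofReal (A * R ^ (-(1 / p))) := by
  have hr0 : 0 < r := by linarith
  have hp0 : 0 < p := by linarith
  set r' := r / (r - 1) with hr'
  have hr'0 : 0 < r' := div_pos hr0 (by linarith)
  have hconj : r'.HolderConjugate r := (Real.HolderConjugate.conjExponent hr).symm
  set θ := 1 - (1 / r - 1 / p) with hθ
  have hexp : -θ * r' = -(r' / p) - 1 := by
    rw [hθ, hr']
    have : r - 1 ≠ 0 := by linarith
    field_simp
    ring
  refine ⟨(p / r') ^ (1 / r'), by positivity, fun g hg hg1 R hR t => ?_⟩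
  have hm : Measurable ((Ioi R).indicator (rieszKernel θ)) :=
    (measurable_rieszKernel θ).indicator measurableSet_Ioi
  refine (ENNReal.lintegral_mul_le_Lp_mul_Lq volume hconj
    (f := fun s => (Ioi R).indicator (rieszKernel θ) (t - s))
    (hm.comp (measurable_const.sub measurable_id)).aemeasurable hg.aemeasurable).trans ?_
  have h1 : ∫⁻ s, (Ioi R).indicator (rieszKernel θ) (t - s) ^ r'
      = ENNReal.ofReal (R ^ (-(r' / p)) * (p / r')) := by
    rw [lintegral_sub_left_eq_self (fun x => (Ioi R).indicator (rieszKernel θ) x ^ r') t]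
    have : (fun x => (Ioi R).indicator (rieszKernel θ) x ^ r')
        = (Ioi R).indicator (fun x => ENNReal.ofReal x ^ (-(r' / p) - 1)) := by
      ext x
      by_cases hx : x ∈ Ioi R
      · have hx0 : x ∈ Ioi (0 : ℝ) := hR.trans hx
        simp only [rieszKernel, indicator_of_mem hx, indicator_of_mem hx0]
        rw [← ENNReal.rpow_mul, hexp]
      · simp [indicator_of_notMem hx, hr'0]
    have hrp' : 0 < r' / p := by positivity
    rw [this, lintegral_indicator measurableSet_Ioi, lintegral_Ioi_rpow (by linarith) hR]
    congr 1
    rw [sub_add_cancel, neg_div_neg_eq]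
    field_simp
  rw [h1]
  calc _ ≤ ENNReal.ofReal (R ^ (-(r' / p)) * (p / r')) ^ (1 / r') * 1 := by
        gcongr
        exact ENNReal.rpow_le_one hg1 (by positivity)
    _ = _ := by
        rw [mul_one, ENNReal.ofReal_rpow_of_nonneg (by positivity) (by positivity),
          Real.mul_rpow (by positivity) (by positivity), ← Real.rpow_mul hR.le, mul_comm]
        congr 3
        field_simp

/-- If the fractional integral exceeds `l`, then at least half of `l` comes from the near part of
the kernel acting on the large values of `g`. -/
theorem ofReal_half_le_lintegral_near {κ l R γ : ℝ} {g : ℝ → ℝ≥0∞} {t : ℝ} (hg : Measurable g)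
    (hκ : 0 < κ) (hl : 0 < l) (hR : 0 < R) (hγR : γ * (R ^ κ / κ) ≤ l / 4)
    (hfar : ∫⁻ s, (Ioi R).indicator (rieszKernel (1 - κ)) (t - s) * g s ≤ ENNReal.ofReal (l / 4))
    (hlt : ENNReal.ofReal l < ∫⁻ s, rieszKernel (1 - κ) (t - s) * g s) :
    ENNReal.ofReal (l / 2) ≤ ∫⁻ s, (Iic R).indicator (rieszKernel (1 - κ)) (t - s) *
      {s | ENNReal.ofReal γ < g s}.indicator g s := by
  set k := rieszKernel (1 - κ) with hk
  have hkm : Measurable k := measurable_rieszKernel _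
  have hkF : Measurable fun s => (Ioi R).indicator k (t - s) :=
    (hkm.indicator measurableSet_Ioi).comp (measurable_const.sub measurable_id)
  have hkN : Measurable fun s => (Iic R).indicator k (t - s) :=
    (hkm.indicator measurableSet_Iic).comp (measurable_const.sub measurable_id)
  set big := {s | ENNReal.ofReal γ < g s}.indicator g with hbig
  have hpt : ∀ s, k (t - s) * g s ≤ (Ioi R).indicator k (t - s) * g s +
      ((Iic R).indicator k (t - s) * ENNReal.ofReal γ + (Iic R).indicator k (t - s) * big s) := by
    intro s
    by_cases h1 : t - s ≤ R
    · rw [indicator_of_mem (show t - s ∈ Iic R from h1),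
        indicator_of_notMem (show t - s ∉ Ioi R from not_lt.2 h1), zero_mul, zero_add, ← mul_add]
      gcongr
      by_cases h2 : ENNReal.ofReal γ < g s
      · rw [hbig, indicator_of_mem (show s ∈ {s | ENNReal.ofReal γ < g s} from h2)]
        exact le_add_self
      · exact (not_lt.1 h2).trans le_self_add
    · rw [indicator_of_mem (show t - s ∈ Ioi R from not_le.1 h1)]
      exact le_self_add
  have hmid : ∫⁻ s, (Iic R).indicator k (t - s) * ENNReal.ofReal γ ≤ ENNReal.ofReal (l / 4) := by
    rw [lintegral_mul_const _ hkN, lintegral_sub_left_eq_self (fun x => (Iic R).indicator k x) t,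
      hk, lintegral_rieszKernel_Iic hκ hR.le, ← ENNReal.ofReal_mul (by positivity), mul_comm]
    exact ENNReal.ofReal_le_ofReal hγR
  have htot := lintegral_mono (μ := volume) hpt
  rw [lintegral_add_left (by exact hkF.mul hg)] at htot
  rw [lintegral_add_left (hkN.mul_const _)] at htot
  have h4 : ENNReal.ofReal l = ENNReal.ofReal (l / 2) + ENNReal.ofReal (l / 2) := by
    rw [← ENNReal.ofReal_add (by positivity) (by positivity)]; ring_nf
  have h5 : ENNReal.ofReal (l / 2) = ENNReal.ofReal (l / 4) + ENNReal.ofReal (l / 4) := by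
    rw [← ENNReal.ofReal_add (by positivity) (by positivity)]; ring_nf
  have h6 := (hlt.le.trans htot).trans (add_le_add hfar (add_le_add_left hmid _))
  rw [← add_assoc, ← h5, h4] at h6
  exact (ENNReal.add_le_add_iff_left ENNReal.ofReal_ne_top).1 h6

/-- Integrating the near part in time. -/
theorem lintegral_near {κ R γ : ℝ} {g : ℝ → ℝ≥0∞} (hg : Measurable g) (hκ : 0 < κ) (hR : 0 ≤ R) :
    ∫⁻ t, ∫⁻ s, (Iic R).indicator (rieszKernel (1 - κ)) (t - s) *
      {s | ENNReal.ofReal γ < g s}.indicator g s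
      = ENNReal.ofReal (R ^ κ / κ) * ∫⁻ s, {s | ENNReal.ofReal γ < g s}.indicator g s := by
  have hkm : Measurable ((Iic R).indicator (rieszKernel (1 - κ))) :=
    (measurable_rieszKernel _).indicator measurableSet_Iic
  have hbm : Measurable ({s | ENNReal.ofReal γ < g s}.indicator g) :=
    hg.indicator (measurableSet_lt measurable_const hg)
  rw [lintegral_lintegral_swap (by
    exact ((hkm.comp (measurable_fst.sub measurable_snd)).mul
      (hbm.comp measurable_snd)).aemeasurable), ← lintegral_const_mul _ hbm]
  refine lintegral_congr fun s => ?_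
  have hkm' : Measurable fun t => (Iic R).indicator (rieszKernel (1 - κ)) (t - s) :=
    hkm.comp (measurable_id.sub measurable_const)
  rw [lintegral_mul_const _ hkm',
    lintegral_sub_right_eq_self (fun x => (Iic R).indicator (rieszKernel (1 - κ)) x) s,
    lintegral_rieszKernel_Iic hκ hR]

theorem hls_normalized {r p : ℝ} (hr : 1 < r) (hrp : r < p) :
    ∃ C : ℝ≥0∞, C ≠ ⊤ ∧ ∀ g : ℝ → ℝ≥0∞, Measurable g → ∫⁻ s, g s ^ r ≤ 1 →
      ∫⁻ t, (∫⁻ s, rieszKernel (1 - (1 / r - 1 / p)) (t - s) * g s) ^ p ≤ C := by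
  obtain ⟨A, hA, hfar⟩ := lintegral_rieszKernel_far_le hr hrp
  have hr0 : 0 < r := by linarith
  have hp0 : 0 < p := by linarith
  set κ := 1 / r - 1 / p with hκdef
  have hκ : 0 < κ := sub_pos.2 (one_div_lt_one_div_of_lt hr0 hrp)
  have hpκ : 1 + p * κ = p / r := by rw [hκdef]; field_simp; ring
  set B := (4 * A) ^ (p * κ) with hB
  have hB0 : 0 < B := by positivity
  set c := κ / (4 * B) with hc
  have hc0 : 0 < c := by positivity
  set b := p - p / r with hb
  have hb0 : 0 < b := by
    rw [hb, sub_pos, div_lt_iff₀ hr0]; nlinarith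
  -- the radius and the threshold attached to the level `l`
  let R : ℝ → ℝ := fun l => (4 * A / l) ^ p
  let γ : ℝ → ℝ := fun l => c * l ^ (p / r)
  have hRκ : ∀ l > 0, R l ^ κ = B * l ^ (-(p * κ)) := by
    intro l hl
    simp only [R]
    rw [← Real.rpow_mul (by positivity), Real.div_rpow (by positivity) hl.le, Real.rpow_neg hl.le]
    rfl
  refine ⟨ENNReal.ofReal p * (ENNReal.ofReal (2 * B / κ) *
    (ENNReal.ofReal c ^ (-(r - 1)) / ENNReal.ofReal b)), ?_, fun g hg hg1 => ?_⟩
  · refine ENNReal.mul_ne_top ENNReal.ofReal_ne_top (ENNReal.mul_ne_top ENNReal.ofReal_ne_top ?_)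
    refine (ENNReal.div_lt_top (ENNReal.rpow_ne_top_of_ne_zero ?_ ENNReal.ofReal_ne_top) ?_).ne <;>
    simpa
  set k := rieszKernel (1 - κ) with hk
  have hkm : Measurable k := measurable_rieszKernel _
  let I : ℝ → ℝ≥0∞ := fun t => ∫⁻ s, k (t - s) * g s
  let Th : ℝ → ℝ → ℝ≥0∞ := fun l t => ∫⁻ s, (Iic (R l)).indicator k (t - s) *
      {s | ENNReal.ofReal (γ l) < g s}.indicator g s
  have hRm : Measurable R := by simp only [R]; fun_prop
  have hγm : Measurable γ := by simp only [γ]; fun_prop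
  have hThm : Measurable (Function.uncurry fun t l => Th l t) := by
    refine Measurable.lintegral_prod_right (f := fun (z : ℝ × ℝ) (s : ℝ) =>
      (Iic (R z.2)).indicator k (z.1 - s) *
      {s | ENNReal.ofReal (γ z.2) < g s}.indicator g s) ?_
    refine Measurable.mul ?_ ?_
    · exact Measurable.ite (p := fun z : (ℝ × ℝ) × ℝ => z.1.1 - z.2 ≤ R z.1.2)
        (measurableSet_le (by fun_prop) (by fun_prop)) (by fun_prop) measurable_const
    · exact Measurable.ite (p := fun z : (ℝ × ℝ) × ℝ => ENNReal.ofReal (γ z.1.2) < g z.2)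
        (measurableSet_lt (by fun_prop) (by fun_prop)) (by fun_prop) measurable_const
  have hpoint : ∀ t, I t ^ p ≤ ENNReal.ofReal p *
      ∫⁻ l in Ioi (0 : ℝ), ENNReal.ofReal (2 * l ^ (p - 2)) * Th l t := by
    intro t
    have h1 := lintegral_rpow_lt hp0 (I t)
    rw [ENNReal.eq_div_iff (by simpa) ENNReal.ofReal_ne_top] at h1
    rw [← h1]
    gcongr _ * ?_
    refine setLIntegral_mono' measurableSet_Ioi fun l hl => ?_
    have hl0 : 0 < l := hl
    by_cases hlt : ENNReal.ofReal l < I t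
    · rw [indicator_of_mem (show l ∈ {x : ℝ | ENNReal.ofReal x < I t} from hlt)]
      have hRp : 0 < R l := by simp only [R]; positivity
      have h2 : ENNReal.ofReal (l / 2) ≤ Th l t := by
        refine ofReal_half_le_lintegral_near hg hκ hl0 hRp
          ?_ ?_ hlt
        · rw [hRκ l hl0]
          simp only [γ]
          rw [hc, ← hpκ, Real.rpow_add hl0, Real.rpow_one, Real.rpow_neg hl0.le]
          have : l ^ (p * κ) ≠ 0 := by positivity
          apply le_of_eq
          field_simp
        · convert hfar g hg hg1 (R l) hRp t using 2
          simp only [R]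
          rw [← Real.rpow_mul (by positivity), mul_neg, mul_one_div_cancel hp0.ne',
            Real.rpow_neg_one]
          field_simp
      calc ENNReal.ofReal l ^ (p - 1) = ENNReal.ofReal (2 * l ^ (p - 2)) * ENNReal.ofReal (l / 2) := by
            rw [ENNReal.ofReal_rpow_of_pos hl0, ← ENNReal.ofReal_mul (by positivity)]
            congr 1
            rw [show p - 1 = p - 2 + 1 by ring, Real.rpow_add hl0, Real.rpow_one]
            ring
        _ ≤ _ := by gcongr
    · rw [indicator_of_notMem (show l ∉ {x : ℝ | ENNReal.ofReal x < I t} from hlt)]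
      exact zero_le
  refine (lintegral_mono hpoint).trans ?_
  rw [lintegral_const_mul' _ _ ENNReal.ofReal_ne_top]
  gcongr
  have hwm : Measurable fun l : ℝ => ENNReal.ofReal (2 * l ^ (p - 2)) := by fun_prop
  rw [lintegral_lintegral_swap ((hwm.comp measurable_snd).mul hThm).aemeasurable]
  have hstep : ∀ l ∈ Ioi (0 : ℝ), ∫⁻ t, ENNReal.ofReal (2 * l ^ (p - 2)) * Th l t
      = ENNReal.ofReal (2 * B / κ) * ∫⁻ s, ENNReal.ofReal l ^ (b - 1) *
        {s | ENNReal.ofReal (γ l) < g s}.indicator g s := by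
    intro l hl
    have hl0 : 0 < l := hl
    have hbm : Measurable ({s | ENNReal.ofReal (γ l) < g s}.indicator g) :=
      hg.indicator (measurableSet_lt measurable_const hg)
    rw [lintegral_const_mul' _ _ ENNReal.ofReal_ne_top, lintegral_near hg hκ (by positivity),
      ← mul_assoc, lintegral_const_mul _ hbm, ← mul_assoc, ENNReal.ofReal_rpow_of_pos hl0,
      ← ENNReal.ofReal_mul (by positivity), ← ENNReal.ofReal_mul (by positivity), hRκ l hl0]
    congr 2
    rw [show b - 1 = p - 2 + -(p * κ) by rw [hb, ← hpκ]; ring, Real.rpow_add hl0]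
    ring
  rw [setLIntegral_congr_fun measurableSet_Ioi hstep,
    lintegral_const_mul' _ _ ENNReal.ofReal_ne_top]
  gcongr
  have hKm : Measurable (Function.uncurry fun l s => ENNReal.ofReal l ^ (b - 1) *
      {s | ENNReal.ofReal (γ l) < g s}.indicator g s) := by
    refine Measurable.mul (by fun_prop) ?_
    exact Measurable.ite (p := fun z : ℝ × ℝ => ENNReal.ofReal (γ z.1) < g z.2)
        (measurableSet_lt (by fun_prop) (by fun_prop)) (by fun_prop) measurable_const
  rw [lintegral_lintegral_swap hKm.aemeasurable]
  have hinner : ∀ s, ∫⁻ l in Ioi (0 : ℝ), ENNReal.ofReal l ^ (b - 1) *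
      {s | ENNReal.ofReal (γ l) < g s}.indicator g s
      = ENNReal.ofReal c ^ (-(r - 1)) / ENNReal.ofReal b * g s ^ r := by
    intro s
    have hcE : ENNReal.ofReal c ≠ 0 := by simpa
    have h1 := lintegral_rpow_lt hb0 ((g s / ENNReal.ofReal c) ^ (r / p))
    have h2 : ∀ l ∈ Ioi (0 : ℝ), ENNReal.ofReal l ^ (b - 1) *
        {s | ENNReal.ofReal (γ l) < g s}.indicator g s =
        {x : ℝ | ENNReal.ofReal x < (g s / ENNReal.ofReal c) ^ (r / p)}.indicator
          (fun x => ENNReal.ofReal x ^ (b - 1)) l * g s := by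
      intro l hl
      have hl0 : 0 < l := hl
      have hiff : ENNReal.ofReal (γ l) < g s ↔
          ENNReal.ofReal l < (g s / ENNReal.ofReal c) ^ (r / p) := by
        rw [show r / p = (p / r)⁻¹ by rw [inv_div], ENNReal.lt_rpow_inv_iff (by positivity),
          ENNReal.lt_div_iff_mul_lt (Or.inl hcE) (Or.inl ENNReal.ofReal_ne_top),
          ENNReal.ofReal_rpow_of_pos hl0, ← ENNReal.ofReal_mul (by positivity), mul_comm]
      by_cases h : ENNReal.ofReal (γ l) < g s
      · rw [indicator_of_mem (show s ∈ {s | ENNReal.ofReal (γ l) < g s} from h),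
          indicator_of_mem (by exact hiff.1 h)]
      · rw [indicator_of_notMem (show s ∉ {s | ENNReal.ofReal (γ l) < g s} from h),
          indicator_of_notMem (by exact fun h' => h (hiff.2 h')), mul_zero, zero_mul]
    rw [setLIntegral_congr_fun measurableSet_Ioi h2, lintegral_mul_const _
      (Measurable.indicator (by fun_prop) (by measurability)), h1, ← ENNReal.rpow_mul,
      show r / p * b = r - 1 by rw [hb]; field_simp,
      ENNReal.div_rpow_of_nonneg _ _ (by linarith), ENNReal.rpow_neg]
    conv_rhs => rw [show r = r - 1 + 1 by ring, ENNReal.rpow_add_of_nonneg _ _ (by linarith) one_pos.le,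
      ENNReal.rpow_one]
    simp only [div_eq_mul_inv, add_sub_cancel_right]
    ring
  simp_rw [hinner]
  rw [lintegral_const_mul _ (by fun_prop)]
  exact mul_le_of_le_one_right' hg1

/-- The Hardy–Littlewood–Sobolev inequality on the line for the one-sided Riesz kernel. -/
theorem hls {r p : ℝ} (hr : 1 < r) (hrp : r < p) :
    ∃ C : ℝ≥0∞, C ≠ ⊤ ∧ ∀ g : ℝ → ℝ≥0∞, Measurable g → ∫⁻ s, g s ^ r ≠ ⊤ →
      ∫⁻ t, (∫⁻ s, rieszKernel (1 - (1 / r - 1 / p)) (t - s) * g s) ^ p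
        ≤ C * (∫⁻ s, g s ^ r) ^ (p / r) := by
  obtain ⟨C, hC, h⟩ := hls_normalized hr hrp
  have hr0 : 0 < r := by linarith
  have hp0 : 0 < p := by linarith
  refine ⟨C, hC, fun g hg hN => ?_⟩
  set N := ∫⁻ s, g s ^ r with hNdef
  by_cases hN0 : N = 0
  · have hg0 : g =ᵐ[volume] 0 := by
      have := (lintegral_eq_zero_iff (hg.pow_const r)).1 hN0
      filter_upwards [this] with s hs
      simpa [hr0, hr0.le, hr0.not_gt] using hs
    have : ∀ t, ∫⁻ s, rieszKernel (1 - (1 / r - 1 / p)) (t - s) * g s = 0 := fun t => by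
      rw [lintegral_eq_zero_of_ae_eq_zero]
      filter_upwards [hg0] with s hs
      simp [hs]
    simp_rw [this]
    simp [hp0]
  · set c := N ^ (-(1 / r)) with hc
    have hc0 : c ≠ 0 := by simp [hc, hN, hN0]
    have hct : c ≠ ⊤ := by simp [hc, hN, hN0]
    have hcr : c ^ r = N⁻¹ := by
      rw [hc, ← ENNReal.rpow_mul, neg_mul, one_div_mul_cancel hr0.ne', ENNReal.rpow_neg_one]
    have hcp : (c⁻¹) ^ p = N ^ (p / r) := by
      rw [hc, ← ENNReal.rpow_neg, neg_neg, ← ENNReal.rpow_mul]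
      congr 1; field_simp
    have h1 := h (fun s => c * g s) (hg.const_mul c) (by
      simp_rw [ENNReal.mul_rpow_of_nonneg _ _ hr0.le]
      rw [lintegral_const_mul _ (hg.pow_const r), hcr, ENNReal.inv_mul_cancel hN0 hN])
    calc _ = ∫⁻ t, c⁻¹ ^ p *
          (∫⁻ s, rieszKernel (1 - (1 / r - 1 / p)) (t - s) * (c * g s)) ^ p := by
          refine lintegral_congr fun t => ?_
          rw [← ENNReal.mul_rpow_of_nonneg _ _ hp0.le,
            ← lintegral_const_mul' _ _ (by simp [hc0])]
          congr 1
          refine lintegral_congr fun s => ?_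
          rw [mul_left_comm _ c, ← mul_assoc c⁻¹, ENNReal.inv_mul_cancel hc0 hct, one_mul]
      _ = N ^ (p / r) * ∫⁻ t,
          (∫⁻ s, rieszKernel (1 - (1 / r - 1 / p)) (t - s) * (c * g s)) ^ p := by
          rw [hcp, lintegral_const_mul' _ _ (by
            exact ENNReal.rpow_ne_top_of_nonneg (by positivity) hN)]
      _ ≤ N ^ (p / r) * C := by gcongr
      _ = _ := mul_comm _ _

/-- Extended-nonnegative version of the Euclidean norm. -/
def eE (ξ : V3) : ℝ≥0∞ := ENNReal.ofReal (en ξ)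

theorem en_nonneg (ξ : V3) : 0 ≤ en ξ := Real.sqrt_nonneg _

theorem en_eq_norm (ξ : V3) : en ξ = ‖(WithLp.toLp 2 ξ : EuclideanSpace ℝ (Fin 3))‖ := by
  simp [en, EuclideanSpace.norm_eq]

theorem measurable_en : Measurable en := by unfold en; fun_prop

theorem measurable_eE : Measurable eE := measurable_en.ennreal_ofReal

theorem abs_le_en (ξ : V3) (i : Fin 3) : |ξ i| ≤ en ξ := by
  rw [en_eq_norm]
  simpa using PiLp.norm_apply_le (WithLp.toLp 2 ξ : EuclideanSpace ℝ (Fin 3)) i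

theorem en_add_le (ξ η : V3) : en (ξ + η) ≤ en ξ + en η := by
  simp only [en_eq_norm, WithLp.toLp_add]
  exact norm_add_le _ _

theorem en_pos {ξ : V3} (h : ξ ≠ 0) : 0 < en ξ := by
  rw [en_eq_norm, norm_pos_iff]
  simpa using h

theorem ae_ne_zero : ∀ᵐ ξ : V3, ξ ≠ 0 := by
  simp [ae_iff]

theorem lintegral_fin_prod (n : ℕ) {f : ℝ → ℝ≥0∞} (hf : Measurable f) :
    ∫⁻ x : Fin n → ℝ, ∏ i, f (x i) = (∫⁻ x, f x) ^ n := by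
  induction n with
  | zero => simp [volume_pi]
  | succ n ih =>
    have h := (volume_preserving_piFinSuccAbove (fun _ : Fin (n + 1) => ℝ) 0).symm
    rw [← h.lintegral_comp_emb (MeasurableEquiv.measurableEmbedding _)]
    simp only [MeasurableEquiv.piFinSuccAbove_symm_apply, Fin.insertNthEquiv_apply,
      Fin.insertNth_zero', Fin.prod_univ_succ, Fin.cons_zero, Fin.cons_succ]
    rw [Measure.volume_eq_prod]
    rw [lintegral_prod_mul (g := fun y : Fin n → ℝ => ∏ i, f (y i)) hf.aemeasurable
      (Measurable.aemeasurable (by fun_prop)), ih, pow_succ']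

theorem lintegral_Icc_abs_rpow_le {b R : ℝ} (hb : 0 < b) (hR : 0 ≤ R) :
    ∫⁻ x in Icc (-R) R, ENNReal.ofReal |x| ^ (b - 1) = 2 * ENNReal.ofReal (R ^ b / b) := by
  have h1 : ∫⁻ x in Ioo (-R) 0, ENNReal.ofReal |x| ^ (b - 1) = ENNReal.ofReal (R ^ b / b) := by
    rw [← lintegral_Ioo_rpow hb hR, ← lintegral_indicator measurableSet_Ioo,
      ← lintegral_indicator measurableSet_Ioo,
      ← lintegral_sub_left_eq_self _ (0 : ℝ)]
    refine lintegral_congr fun x => ?_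
    simp only [indicator, mem_Ioo, zero_sub, abs_neg]
    by_cases h : 0 < x ∧ x < R
    · rw [if_pos h, if_pos ⟨by linarith, by linarith⟩, abs_of_pos h.1]
    · rw [if_neg h, if_neg fun h' => h ⟨by linarith, by linarith⟩]
  have h2 : ∫⁻ x in Ioo 0 R, ENNReal.ofReal |x| ^ (b - 1) = ENNReal.ofReal (R ^ b / b) := by
    rw [← lintegral_Ioo_rpow hb hR]
    exact setLIntegral_congr_fun measurableSet_Ioo fun x hx => by simp only [abs_of_pos hx.1]
  rw [← Ico_union_Icc_eq_Icc (b := 0) (by linarith) hR, lintegral_union measurableSet_Icc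
    (by rw [Set.disjoint_left]; intro x hx hx'; exact absurd hx.2 (not_lt.2 hx'.1)),
    setLIntegral_congr Ioo_ae_eq_Ico.symm, setLIntegral_congr Ioo_ae_eq_Icc.symm, h1, h2, two_mul]

theorem lintegral_ball_en_rpow_le {a : ℝ} (ha : 0 ≤ a) (ha3 : a < 3) :
    ∃ C : ℝ≥0∞, C ≠ ⊤ ∧ ∀ R : ℝ, 0 ≤ R →
      ∫⁻ η in {η : V3 | en η ≤ R}, eE η ^ (-a) ≤ C * ENNReal.ofReal R ^ (3 - a) := by
  set b := 1 - a / 3 with hb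
  have hb0 : 0 < b := by rw [hb]; linarith
  refine ⟨(2 * ENNReal.ofReal (1 / b)) ^ 3, by finiteness, fun R hR => ?_⟩
  have hm : MeasurableSet {η : V3 | en η ≤ R} := measurableSet_le measurable_en measurable_const
  have hpt : ∀ η : V3, {η : V3 | en η ≤ R}.indicator (fun η => eE η ^ (-a)) η
      ≤ ∏ i, (Icc (-R) R).indicator (fun x => ENNReal.ofReal |x| ^ (b - 1)) (η i) := by
    intro η
    by_cases h : en η ≤ R
    · rw [indicator_of_mem (by exact h)]
      have : ∀ i, (Icc (-R) R).indicator (fun x => ENNReal.ofReal |x| ^ (b - 1)) (η i)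
          = ENNReal.ofReal |η i| ^ (b - 1) := fun i =>
        indicator_of_mem (mem_Icc.2 (abs_le.1 ((abs_le_en η i).trans h))) _
      simp_rw [this]
      calc eE η ^ (-a) = ∏ _i : Fin 3, eE η ^ (b - 1) := by
            rw [Finset.prod_const, Finset.card_univ, Fintype.card_fin, ← ENNReal.rpow_mul_natCast]
            congr 1; rw [hb]; push_cast; ring
        _ ≤ _ := by
            refine Finset.prod_le_prod' fun i _ => ?_
            rw [show b - 1 = -(a / 3) by rw [hb]; ring, ENNReal.rpow_neg, ENNReal.rpow_neg]
            gcongr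
            exact ENNReal.ofReal_le_ofReal (abs_le_en η i)
    · rw [indicator_of_notMem (by exact h)]
      exact zero_le
  rw [← lintegral_indicator hm]
  refine (lintegral_mono hpt).trans ?_
  rw [lintegral_fin_prod 3 (f := (Icc (-R) R).indicator (fun x => ENNReal.ofReal |x| ^ (b - 1)))
    (Measurable.indicator (by fun_prop) measurableSet_Icc), lintegral_indicator measurableSet_Icc,
    lintegral_Icc_abs_rpow_le hb0 hR]
  apply le_of_eq
  rw [show 3 - a = b * (3 : ℕ) by rw [hb]; push_cast; ring, ENNReal.rpow_mul_natCast, ← mul_pow,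
    mul_assoc, ENNReal.ofReal_rpow_of_nonneg hR hb0.le, ← ENNReal.ofReal_mul (by positivity),
    one_div_mul_eq_div]

/-- Cauchy–Schwarz for lower Lebesgue integrals. -/
theorem sq_lintegral_mul_le {X : Type*} [MeasurableSpace X] (μ : Measure X) {u v : X → ℝ≥0∞}
    (hu : AEMeasurable u μ) (hv : AEMeasurable v μ) :
    (∫⁻ x, u x * v x ∂μ) ^ 2 ≤ (∫⁻ x, u x ^ 2 ∂μ) * ∫⁻ x, v x ^ 2 ∂μ := by
  have h := ENNReal.lintegral_mul_le_Lp_mul_Lq μ Real.HolderConjugate.two_two hu hv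
  have h2 := pow_le_pow_left' h 2
  simp only [Pi.mul_apply, mul_pow, ← ENNReal.rpow_mul_natCast, ENNReal.rpow_two] at h2
  simpa using h2

theorem ennreal_add_sq_le (a b : ℝ≥0∞) : (a + b) ^ 2 ≤ 2 * a ^ 2 + 2 * b ^ 2 := by
  have h := ENNReal.rpow_add_le_mul_rpow_add_rpow a b one_le_two
  norm_num [mul_add] at h
  exact h

theorem eE_ne_top (ξ : V3) : eE ξ ≠ ⊤ := ENNReal.ofReal_ne_top

theorem eE_ne_zero {ξ : V3} (h : ξ ≠ 0) : eE ξ ≠ 0 := by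
  simpa [eE] using en_pos h

theorem eE_le_two_mul {ξ η : V3} (h : en ξ ≤ 2 * en η) : eE ξ ≤ 2 * eE η := by
  rw [eE, eE, ← ENNReal.ofReal_ofNat, ← ENNReal.ofReal_mul (by norm_num)]
  exact ENNReal.ofReal_le_ofReal h

theorem eE_rpow_neg_mul_cancel {η : V3} (hη : η ≠ 0) (σ : ℝ) (x : ℝ≥0∞) :
    eE η ^ (-σ) * (eE η ^ σ * x) = x := by
  rw [← mul_assoc, ← ENNReal.rpow_add _ _ (eE_ne_zero hη) (eE_ne_top η), neg_add_cancel,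
    ENNReal.rpow_zero, one_mul]

theorem rpow_neg_le_of_le_mul {a b c : ℝ≥0∞} {σ : ℝ} (hc : c ≠ 0) (hc' : c ≠ ⊤) (hσ : 0 ≤ σ)
    (h : a ≤ c * b) : b ^ (-σ) ≤ c ^ σ * a ^ (-σ) := by
  have h1 : a ^ σ ≤ c ^ σ * b ^ σ := by
    rw [← ENNReal.mul_rpow_of_nonneg _ _ hσ]; gcongr
  have h0 : c ^ σ ≠ 0 := by simp [hc, hc', ENNReal.rpow_eq_zero_iff]
  have ht : c ^ σ ≠ ⊤ := ENNReal.rpow_ne_top_of_nonneg hσ hc'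
  calc b ^ (-σ) = c ^ σ * (c ^ σ * b ^ σ)⁻¹ := by
        rw [ENNReal.mul_inv (Or.inl h0) (Or.inl ht), ← mul_assoc, ENNReal.mul_inv_cancel h0 ht,
          one_mul, ENNReal.rpow_neg]
    _ ≤ _ := by
        rw [ENNReal.rpow_neg]
        gcongr

/-- The part of `f ∗ f` where the first frequency is at most half of the output frequency. -/
def lowHigh (f : V3 → ℝ≥0∞) (ξ : V3) : ℝ≥0∞ :=
  ∫⁻ η, {η : V3 | 2 * en η ≤ en ξ}.indicator (fun η => f η * f (ξ - η)) η

/-- The part of `f ∗ f` where the output frequency is at most twice the second frequency and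
the two frequencies are comparable. -/
def highHigh (f : V3 → ℝ≥0∞) (ξ : V3) : ℝ≥0∞ :=
  ∫⁻ η, {η : V3 | en ξ ≤ 2 * en (ξ - η) ∧ en (ξ - η) ≤ 3 * en η}.indicator
    (fun η => f η * f (ξ - η)) η

theorem measurableSet_low (ξ : V3) : MeasurableSet {η : V3 | 2 * en η ≤ en ξ} :=
  measurableSet_le (measurable_en.const_mul 2) measurable_const

theorem selfConv_le {f : V3 → ℝ≥0∞} (hf : Measurable f) (ξ : V3) :
    ∫⁻ η, f η * f (ξ - η) ≤ 2 * lowHigh f ξ + highHigh f ξ := by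
  have hsub : Measurable fun η : V3 => ξ - η := by fun_prop
  have hF : Measurable ({η : V3 | 2 * en η ≤ en ξ}.indicator fun η => f η * f (ξ - η)) :=
    (hf.mul (hf.comp hsub)).indicator (measurableSet_low ξ)
  have hsymm : ∫⁻ η, {η : V3 | 2 * en (ξ - η) ≤ en ξ}.indicator (fun η => f η * f (ξ - η)) η
      = lowHigh f ξ := by
    rw [lowHigh, ← lintegral_sub_left_eq_self _ ξ]
    refine lintegral_congr fun η => ?_
    simp only [indicator, mem_ofPred_eq, sub_sub_cancel, mul_comm (f η)]
  rw [two_mul, add_assoc]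
  nth_rewrite 2 [← hsymm]
  rw [lowHigh, highHigh, ← lintegral_add_left (by
    exact (hf.mul (hf.comp hsub)).indicator
      (measurableSet_le ((measurable_en.comp hsub).const_mul 2) measurable_const)),
    ← lintegral_add_left hF]
  refine lintegral_mono fun η => ?_
  by_cases h1 : 2 * en η ≤ en ξ
  · rw [indicator_of_mem (by exact h1)]
    exact le_self_add
  by_cases h2 : 2 * en (ξ - η) ≤ en ξ
  · rw [indicator_of_mem (s := {η : V3 | 2 * en (ξ - η) ≤ en ξ}) (by exact h2)]
    exact le_add_left le_self_add
  · have h3 : en (ξ - η) ≤ 3 * en η := by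
      have h := en_add_le ξ (-η)
      have : en (-η) = en η := by simp [en]
      rw [← sub_eq_add_neg, this] at h
      linarith
    rw [indicator_of_mem (s := {η : V3 | en ξ ≤ 2 * en (ξ - η) ∧ en (ξ - η) ≤ 3 * en η})
      (by exact ⟨by linarith, h3⟩)]
    exact le_add_left le_add_self

theorem lintegral_selfConv {h : V3 → ℝ≥0∞} (hh : Measurable h) :
    ∫⁻ ξ, ∫⁻ η, h η * h (ξ - η) = (∫⁻ η, h η) ^ 2 := by
  rw [lintegral_lintegral_swap (by
    exact ((hh.comp measurable_snd).mul (hh.comp (measurable_fst.sub measurable_snd))).aemeasurable)]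
  have : ∀ η, ∫⁻ ξ, h η * h (ξ - η) = h η * ∫⁻ ζ, h ζ := fun η => by
    rw [lintegral_const_mul _ (by fun_prop), lintegral_sub_right_eq_self h η]
  simp_rw [this]
  rw [lintegral_mul_const _ hh, sq]

theorem lintegral_lowHigh_le {σ : ℝ} (hσ : 0 < σ) (hσ' : σ < 3 / 2) :
    ∃ C : ℝ≥0∞, C ≠ ⊤ ∧ ∀ f : V3 → ℝ≥0∞, Measurable f →
      ∫⁻ ξ, (eE ξ ^ (2 * σ - 3 / 2) * lowHigh f ξ) ^ 2 ≤ C * (∫⁻ η, (eE η ^ σ * f η) ^ 2) ^ 2 := by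
  obtain ⟨C, hC, hball⟩ := lintegral_ball_en_rpow_le (a := 2 * σ) (by linarith) (by linarith)
  refine ⟨(2 ^ σ) ^ 2 * C, ENNReal.mul_ne_top (ENNReal.pow_ne_top
    (ENNReal.rpow_ne_top_of_nonneg hσ.le (by simp))) hC, fun f hf => ?_⟩
  set φ : V3 → ℝ≥0∞ := fun η => eE η ^ σ * f η with hφ
  have hφm : Measurable φ := (measurable_eE.pow_const σ).mul hf
  have hpt : ∀ᵐ ξ : V3, (eE ξ ^ (2 * σ - 3 / 2) * lowHigh f ξ) ^ 2
      ≤ (2 ^ σ) ^ 2 * C * ∫⁻ η, φ η ^ 2 * φ (ξ - η) ^ 2 := by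
    filter_upwards [ae_ne_zero] with ξ hξ
    have hE0 := eE_ne_zero hξ
    have hEt := eE_ne_top ξ
    have h1 : lowHigh f ξ ≤ 2 ^ σ * eE ξ ^ (-σ) *
        ∫⁻ η, {η : V3 | 2 * en η ≤ en ξ}.indicator (fun η => eE η ^ (-σ)) η *
          (φ η * φ (ξ - η)) := by
      rw [lowHigh, ← lintegral_const_mul' _ _ (ENNReal.mul_ne_top
        (ENNReal.rpow_ne_top_of_nonneg hσ.le (by simp))
        (ENNReal.rpow_ne_top_of_ne_zero hE0 hEt))]
      refine lintegral_mono_ae ?_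
      filter_upwards [ae_ne_zero] with η hη
      by_cases h : 2 * en η ≤ en ξ
      · rw [indicator_of_mem (by exact h), indicator_of_mem (by exact h)]
        have h2 : en ξ ≤ 2 * en (ξ - η) := by
          have h := en_add_le (ξ - η) η
          rw [sub_add_cancel] at h
          linarith
        have hζ : ξ - η ≠ 0 := by
          intro h0
          rw [h0] at h2
          have : en 0 = 0 := by simp [en]
          have := en_pos hξ
          linarith
        have h3 := rpow_neg_le_of_le_mul (σ := σ) (by simp) (by simp) hσ.le (eE_le_two_mul h2)
        calc f η * f (ξ - η) = (eE η ^ (-σ) * φ η) * (eE (ξ - η) ^ (-σ) * φ (ξ - η)) := by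
              simp only [hφ]
              rw [eE_rpow_neg_mul_cancel hη, eE_rpow_neg_mul_cancel hζ]
          _ ≤ (eE η ^ (-σ) * φ η) * (2 ^ σ * eE ξ ^ (-σ) * φ (ξ - η)) := by gcongr
          _ = _ := by ring
      · rw [indicator_of_notMem (by exact h)]
        exact zero_le
    have h2 : (∫⁻ η, {η : V3 | 2 * en η ≤ en ξ}.indicator (fun η => eE η ^ (-σ)) η *
          (φ η * φ (ξ - η))) ^ 2 ≤ C * eE ξ ^ (3 - 2 * σ) * ∫⁻ η, φ η ^ 2 * φ (ξ - η) ^ 2 := by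
      refine (sq_lintegral_mul_le volume ((measurable_eE.pow_const (-σ)).indicator
        (measurableSet_low ξ)).aemeasurable (Measurable.aemeasurable (by fun_prop))).trans ?_
      simp only [mul_pow]
      gcongr
      calc _ = ∫⁻ η in {η : V3 | en η ≤ en ξ / 2}, eE η ^ (-(2 * σ)) := by
            rw [← lintegral_indicator (measurableSet_le measurable_en measurable_const)]
            refine lintegral_congr fun η => ?_
            by_cases h : 2 * en η ≤ en ξ
            · rw [indicator_of_mem (by exact h), indicator_of_mem (by
                show en η ≤ en ξ / 2; linarith), ← ENNReal.rpow_mul_natCast]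
              congr 1; push_cast; ring
            · rw [indicator_of_notMem (by exact h), indicator_of_notMem (by
                show ¬ (en η ≤ en ξ / 2); intro h'; apply h; linarith)]
              simp
        _ ≤ _ := hball _ (by have := en_nonneg ξ; positivity)
        _ ≤ _ := by
            have hle : ENNReal.ofReal (en ξ / 2) ≤ eE ξ :=
              ENNReal.ofReal_le_ofReal (by have := en_nonneg ξ; linarith)
            have h0 : 0 ≤ 3 - 2 * σ := by linarith
            gcongr
    calc _ ≤ (eE ξ ^ (2 * σ - 3 / 2) * (2 ^ σ * eE ξ ^ (-σ) *
        ∫⁻ η, {η : V3 | 2 * en η ≤ en ξ}.indicator (fun η => eE η ^ (-σ)) η *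
          (φ η * φ (ξ - η)))) ^ 2 := by gcongr
      _ = (2 ^ σ) ^ 2 * ((eE ξ ^ (2 * σ - 3 / 2)) ^ 2 * (eE ξ ^ (-σ)) ^ 2) * (
        ∫⁻ η, {η : V3 | 2 * en η ≤ en ξ}.indicator (fun η => eE η ^ (-σ)) η *
          (φ η * φ (ξ - η))) ^ 2 := by ring
      _ ≤ (2 ^ σ) ^ 2 * ((eE ξ ^ (2 * σ - 3 / 2)) ^ 2 * (eE ξ ^ (-σ)) ^ 2) *
          (C * eE ξ ^ (3 - 2 * σ) * ∫⁻ η, φ η ^ 2 * φ (ξ - η) ^ 2) := by gcongr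
      _ = (2 ^ σ) ^ 2 * C * ((eE ξ ^ (2 * σ - 3 / 2)) ^ 2 * (eE ξ ^ (-σ)) ^ 2 *
          eE ξ ^ (3 - 2 * σ)) * ∫⁻ η, φ η ^ 2 * φ (ξ - η) ^ 2 := by ring
      _ = _ := by
        rw [← ENNReal.rpow_mul_natCast (eE ξ), ← ENNReal.rpow_mul_natCast (eE ξ),
          ← ENNReal.rpow_add _ _ hE0 hEt,
          ← ENNReal.rpow_add _ _ hE0 hEt]
        have : (2 * σ - 3 / 2) * (2 : ℕ) + -σ * (2 : ℕ) + (3 - 2 * σ) = 0 := by push_cast; ring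
        rw [this, ENNReal.rpow_zero, mul_one]
  refine (lintegral_mono_ae hpt).trans ?_
  rw [lintegral_const_mul _ (Measurable.lintegral_prod_right (f := fun (ξ η : V3) =>
    φ η ^ 2 * φ (ξ - η) ^ 2) (by fun_prop)), lintegral_selfConv (h := fun η => φ η ^ 2) (by fun_prop)]

theorem lintegral_highHigh_le {σ : ℝ} (hσ : 1 / 2 < σ) :
    ∃ C : ℝ≥0∞, C ≠ ⊤ ∧ ∀ f : V3 → ℝ≥0∞, Measurable f →
      ∫⁻ ξ, (eE ξ ^ (2 * σ - 3 / 2) * highHigh f ξ) ^ 2 ≤ C * (∫⁻ η, (eE η ^ σ * f η) ^ 2) ^ 2 := by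
  obtain ⟨C, hC, hball⟩ := lintegral_ball_en_rpow_le (a := 1) (by norm_num) (by norm_num)
  have hσ0 : 0 ≤ σ := by linarith
  have h3t : (3 : ℝ≥0∞) ^ σ ≠ ⊤ := ENNReal.rpow_ne_top_of_nonneg hσ0 (by simp)
  refine ⟨(3 ^ σ) ^ 2 * (C * 2 ^ (4 * σ)), ENNReal.mul_ne_top (ENNReal.pow_ne_top h3t)
    (ENNReal.mul_ne_top hC (ENNReal.rpow_ne_top_of_nonneg (by linarith) (by simp))),
    fun f hf => ?_⟩
  set φ : V3 → ℝ≥0∞ := fun η => eE η ^ σ * f η with hφ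
  have hφm : Measurable φ := (measurable_eE.pow_const σ).mul hf
  let K : V3 → V3 → ℝ≥0∞ := fun ξ ζ =>
    {z : V3 × V3 | en z.1 ≤ 2 * en z.2}.indicator
      (fun z => eE z.2 ^ (-(2 * σ)) * φ z.2) (ξ, ζ)
  have hK : Measurable fun z : V3 × V3 => K z.1 z.2 :=
    Measurable.indicator (((measurable_eE.comp measurable_snd).pow_const _).mul
      (hφm.comp measurable_snd)) (measurableSet_le (measurable_en.comp measurable_fst)
        ((measurable_en.comp measurable_snd).const_mul 2))
  have hKξ : ∀ ξ, Measurable (K ξ) := fun ξ => hK.comp (measurable_const.prodMk measurable_id)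
  have hpt : ∀ ξ : V3, (eE ξ ^ (2 * σ - 3 / 2) * highHigh f ξ) ^ 2
      ≤ (3 ^ σ) ^ 2 * (∫⁻ η, φ η ^ 2) * ∫⁻ ζ, eE ξ ^ (4 * σ - 3) * K ξ ζ ^ 2 := by
    intro ξ
    have h1 : highHigh f ξ ≤ 3 ^ σ * ∫⁻ η, φ η * K ξ (ξ - η) := by
      rw [highHigh, ← lintegral_const_mul' _ _ h3t]
      refine lintegral_mono_ae ?_
      have hne : ∀ᵐ η : V3, ξ - η ≠ 0 := by
        filter_upwards [compl_mem_ae_iff.2 (measure_singleton ξ)] with η h h0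
        exact h (sub_eq_zero.1 h0).symm
      filter_upwards [ae_ne_zero, hne] with η hη hζ
      by_cases h : en ξ ≤ 2 * en (ξ - η) ∧ en (ξ - η) ≤ 3 * en η
      · have hc : eE (ξ - η) ≤ 3 * eE η := by
          rw [eE, eE, ← ENNReal.ofReal_ofNat, ← ENNReal.ofReal_mul (by norm_num)]
          exact ENNReal.ofReal_le_ofReal h.2
        have h3 := rpow_neg_le_of_le_mul (σ := σ) (by simp) (by simp) hσ0 hc
        have hKv : K ξ (ξ - η) = eE (ξ - η) ^ (-(2 * σ)) * φ (ξ - η) :=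
          indicator_of_mem (by exact h.1) _
        rw [indicator_of_mem (by exact h), hKv]
        calc f η * f (ξ - η) = (eE η ^ (-σ) * φ η) * (eE (ξ - η) ^ (-σ) * φ (ξ - η)) := by
              simp only [hφ]
              rw [eE_rpow_neg_mul_cancel hη, eE_rpow_neg_mul_cancel hζ]
          _ ≤ (3 ^ σ * eE (ξ - η) ^ (-σ) * φ η) * (eE (ξ - η) ^ (-σ) * φ (ξ - η)) := by gcongr
          _ = 3 ^ σ * (φ η * ((eE (ξ - η) ^ (-σ) * eE (ξ - η) ^ (-σ)) * φ (ξ - η))) := by ring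
          _ = _ := by
            rw [← ENNReal.rpow_add _ _ (eE_ne_zero hζ) (eE_ne_top _)]
            congr 4
            ring_nf
      · rw [indicator_of_notMem (by exact h)]
        exact zero_le
    have h2 : (∫⁻ η, φ η * K ξ (ξ - η)) ^ 2 ≤ (∫⁻ η, φ η ^ 2) * ∫⁻ ζ, K ξ ζ ^ 2 := by
      refine (sq_lintegral_mul_le volume hφm.aemeasurable
        ((hKξ ξ).comp (measurable_const.sub measurable_id)).aemeasurable).trans_eq ?_
      congr 1
      exact lintegral_sub_left_eq_self (fun ζ => K ξ ζ ^ 2) ξ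
    rw [lintegral_const_mul _ ((hKξ ξ).pow_const 2)]
    calc _ ≤ (eE ξ ^ (2 * σ - 3 / 2) * (3 ^ σ * ∫⁻ η, φ η * K ξ (ξ - η))) ^ 2 := by gcongr
      _ = (eE ξ ^ (2 * σ - 3 / 2)) ^ 2 * (3 ^ σ) ^ 2 * (∫⁻ η, φ η * K ξ (ξ - η)) ^ 2 := by ring
      _ ≤ (eE ξ ^ (2 * σ - 3 / 2)) ^ 2 * (3 ^ σ) ^ 2 *
          ((∫⁻ η, φ η ^ 2) * ∫⁻ ζ, K ξ ζ ^ 2) := by gcongr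
      _ = _ := by
        rw [← ENNReal.rpow_mul_natCast, show (2 * σ - 3 / 2) * (2 : ℕ) = 4 * σ - 3 by
          push_cast; ring]
        ring
  have hjm : Measurable fun z : V3 × V3 => eE z.1 ^ (4 * σ - 3) * K z.1 z.2 ^ 2 :=
    ((measurable_eE.comp measurable_fst).pow_const _).mul (hK.pow_const 2)
  refine (lintegral_mono hpt).trans ?_
  rw [lintegral_const_mul _ (Measurable.lintegral_prod_right (f := fun (ξ ζ : V3) =>
    eE ξ ^ (4 * σ - 3) * K ξ ζ ^ 2) hjm), lintegral_lintegral_swap hjm.aemeasurable]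
  have hin : ∀ᵐ ζ : V3, ∫⁻ ξ, eE ξ ^ (4 * σ - 3) * K ξ ζ ^ 2 ≤ C * 2 ^ (4 * σ) * φ ζ ^ 2 := by
    filter_upwards [ae_ne_zero] with ζ hζ
    have hE0 := eE_ne_zero hζ
    have hEt := eE_ne_top ζ
    have h1 : ∀ᵐ ξ : V3, eE ξ ^ (4 * σ - 3) * K ξ ζ ^ 2 ≤
        {ξ : V3 | en ξ ≤ 2 * en ζ}.indicator (fun ξ => eE ξ ^ (-1 : ℝ)) ξ *
          ((2 * eE ζ) ^ (4 * σ - 2) * (eE ζ ^ (-(2 * σ)) * φ ζ) ^ 2) := by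
      filter_upwards [ae_ne_zero] with ξ hξ
      by_cases h : en ξ ≤ 2 * en ζ
      · have hKv : K ξ ζ = eE ζ ^ (-(2 * σ)) * φ ζ := indicator_of_mem (by exact h) _
        rw [indicator_of_mem (by exact h), hKv,
          show 4 * σ - 3 = -1 + (4 * σ - 2) by ring,
          ENNReal.rpow_add _ _ (eE_ne_zero hξ) (eE_ne_top ξ), mul_assoc]
        gcongr
        · linarith
        · exact eE_le_two_mul h
      · have hKv : K ξ ζ = 0 := indicator_of_notMem (by exact h) _
        rw [hKv]
        simp
    refine (lintegral_mono_ae h1).trans ?_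
    have hms : MeasurableSet {ξ : V3 | en ξ ≤ 2 * en ζ} :=
      measurableSet_le measurable_en measurable_const
    rw [lintegral_mul_const _ ((measurable_eE.pow_const _).indicator hms),
      lintegral_indicator hms]
    have h2 : ENNReal.ofReal (2 * en ζ) = 2 * eE ζ := by
      rw [ENNReal.ofReal_mul (by norm_num), ENNReal.ofReal_ofNat, eE]
    have h2E0 : 2 * eE ζ ≠ 0 := mul_ne_zero (by simp) hE0
    have h2Et : 2 * eE ζ ≠ ⊤ := ENNReal.mul_ne_top (by simp) hEt
    calc _ ≤ C * (2 * eE ζ) ^ (3 - 1 : ℝ) *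
          ((2 * eE ζ) ^ (4 * σ - 2) * (eE ζ ^ (-(2 * σ)) * φ ζ) ^ 2) := by
          rw [← h2]
          gcongr
          exact hball _ (by have := en_nonneg ζ; positivity)
      _ = C * ((2 * eE ζ) ^ (3 - 1 : ℝ) * (2 * eE ζ) ^ (4 * σ - 2)) *
          ((eE ζ ^ (-(2 * σ))) ^ 2 * φ ζ ^ 2) := by ring
      _ = C * (2 ^ (4 * σ) * eE ζ ^ (4 * σ)) * (eE ζ ^ (-(4 * σ)) * φ ζ ^ 2) := by
          rw [← ENNReal.rpow_add _ _ h2E0 h2Et, ← ENNReal.rpow_mul_natCast,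
            ← ENNReal.mul_rpow_of_nonneg _ _ (by linarith)]
          congr 4
          · ring
          · push_cast; ring
      _ = C * 2 ^ (4 * σ) * φ ζ ^ 2 * (eE ζ ^ (4 * σ) * eE ζ ^ (-(4 * σ))) := by ring
      _ = _ := by
          rw [← ENNReal.rpow_add _ _ hE0 hEt, add_neg_cancel, ENNReal.rpow_zero, mul_one]
  calc _ ≤ (3 ^ σ) ^ 2 * (∫⁻ η, φ η ^ 2) * ∫⁻ ζ, C * 2 ^ (4 * σ) * φ ζ ^ 2 := by
        gcongr _ * ?_
        exact lintegral_mono_ae hin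
    _ = _ := by
        rw [lintegral_const_mul _ (hφm.pow_const 2)]
        ring

/-- The product law `Ḣ^σ · Ḣ^σ ⊆ Ḣ^(2σ - 3/2)` on the Fourier side. -/
theorem lintegral_selfConv_le {σ : ℝ} (hσ : 1 / 2 < σ) (hσ' : σ < 3 / 2) :
    ∃ C : ℝ≥0∞, C ≠ ⊤ ∧ ∀ f : V3 → ℝ≥0∞, Measurable f →
      ∫⁻ ξ, (eE ξ ^ (2 * σ - 3 / 2) * ∫⁻ η, f η * f (ξ - η)) ^ 2
        ≤ C * (∫⁻ η, (eE η ^ σ * f η) ^ 2) ^ 2 := by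
  obtain ⟨C₁, hC₁, h₁⟩ := lintegral_lowHigh_le (by linarith) hσ'
  obtain ⟨C₂, hC₂, h₂⟩ := lintegral_highHigh_le hσ
  refine ⟨8 * C₁ + 2 * C₂, by finiteness, fun f hf => ?_⟩
  have hlm : Measurable (lowHigh f) := by
    refine Measurable.lintegral_prod_right (f := fun (ξ η : V3) =>
      {η : V3 | 2 * en η ≤ en ξ}.indicator (fun η => f η * f (ξ - η)) η) ?_
    exact Measurable.ite (p := fun z : V3 × V3 => 2 * en z.2 ≤ en z.1)
      (measurableSet_le ((measurable_en.comp measurable_snd).const_mul 2)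
        (measurable_en.comp measurable_fst)) (by fun_prop) measurable_const
  calc _ ≤ ∫⁻ ξ, (8 * (eE ξ ^ (2 * σ - 3 / 2) * lowHigh f ξ) ^ 2
          + 2 * (eE ξ ^ (2 * σ - 3 / 2) * highHigh f ξ) ^ 2) := by
        refine lintegral_mono fun ξ => ?_
        calc _ ≤ (eE ξ ^ (2 * σ - 3 / 2) * (2 * lowHigh f ξ + highHigh f ξ)) ^ 2 := by
              gcongr; exact selfConv_le hf ξ
          _ = (eE ξ ^ (2 * σ - 3 / 2)) ^ 2 * (2 * lowHigh f ξ + highHigh f ξ) ^ 2 := by ring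
          _ ≤ (eE ξ ^ (2 * σ - 3 / 2)) ^ 2 *
              (2 * (2 * lowHigh f ξ) ^ 2 + 2 * highHigh f ξ ^ 2) := by
              gcongr; exact ennreal_add_sq_le _ _
          _ = _ := by ring
    _ ≤ _ := by
        have hm1 : Measurable fun ξ => (eE ξ ^ (2 * σ - 3 / 2) * lowHigh f ξ) ^ 2 :=
          ((measurable_eE.pow_const _).mul hlm).pow_const 2
        rw [lintegral_add_left (hm1.const_mul 8), lintegral_const_mul _ hm1,
          lintegral_const_mul' _ _ (by simp), add_mul, mul_assoc, mul_assoc]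
        gcongr
        · exact h₁ f hf
        · exact h₂ f hf

/-- Minkowski's integral inequality in `L²`. -/
theorem sq_lintegral_lintegral_le {X Y : Type*} [MeasurableSpace X] [MeasurableSpace Y]
    {μ : Measure X} {ν : Measure Y} [SFinite μ] [SFinite ν] {F : X → Y → ℝ≥0∞}
    (hF : Measurable (Function.uncurry F)) :
    ∫⁻ y, (∫⁻ x, F x y ∂μ) ^ 2 ∂ν ≤ (∫⁻ x, (∫⁻ y, F x y ^ 2 ∂ν) ^ (1 / 2 : ℝ) ∂μ) ^ 2 := by
  have hFx : ∀ x, Measurable (F x) := fun x => hF.comp measurable_prodMk_left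
  have hFy : ∀ y, Measurable fun x => F x y := fun y => hF.comp measurable_prodMk_right
  have hn : Measurable fun x => (∫⁻ y, F x y ^ 2 ∂ν) ^ (1 / 2 : ℝ) :=
    (Measurable.lintegral_prod_right (f := fun x y => F x y ^ 2) (hF.pow_const 2)).pow_const _
  have hI : Measurable fun y => ∫⁻ x, F x y ∂μ :=
    Measurable.lintegral_prod_left (f := F) hF
  calc _ = ∫⁻ y, ∫⁻ x, F x y * ∫⁻ x', F x' y ∂μ ∂μ ∂ν := by
        refine lintegral_congr fun y => ?_
        rw [lintegral_mul_const _ (hFy y), sq]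
    _ = ∫⁻ x, ∫⁻ y, F x y * ∫⁻ x', F x' y ∂μ ∂ν ∂μ := by
        refine lintegral_lintegral_swap (Measurable.aemeasurable ?_)
        exact (hF.comp measurable_swap).mul (hI.comp measurable_fst)
    _ = ∫⁻ x, ∫⁻ x', ∫⁻ y, F x y * F x' y ∂ν ∂μ ∂μ := by
        refine lintegral_congr fun x => ?_
        rw [lintegral_lintegral_swap (f := fun x' y => F x y * F x' y)
          (Measurable.aemeasurable (((hFx x).comp measurable_snd).mul hF))]
        refine lintegral_congr fun y => ?_
        rw [lintegral_const_mul _ (hFy y)]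
    _ ≤ ∫⁻ x, ∫⁻ x', (∫⁻ y, F x y ^ 2 ∂ν) ^ (1 / 2 : ℝ) *
          (∫⁻ y, F x' y ^ 2 ∂ν) ^ (1 / 2 : ℝ) ∂μ ∂μ := by
        refine lintegral_mono fun x => lintegral_mono fun x' => ?_
        have := sq_lintegral_mul_le ν (hFx x).aemeasurable (hFx x').aemeasurable
        rw [← ENNReal.mul_rpow_of_nonneg _ _ (by norm_num)]
        rwa [one_div, ENNReal.le_rpow_inv_iff two_pos, ENNReal.rpow_two]
    _ = _ := by
        simp_rw [lintegral_const_mul _ hn]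
        rw [lintegral_mul_const _ hn, sq]

theorem abs_qsym_le (α : Coeffs) (j m k l : Fin 3) (ξ : V3) :
    |qsym α j m k l ξ| ≤ ∑ n, ∑ p, |α j m n p k l| := by
  refine (Finset.abs_sum_le_sum_abs _ _).trans (Finset.sum_le_sum fun n _ =>
    (Finset.abs_sum_le_sum_abs _ _).trans (Finset.sum_le_sum fun p _ => ?_))
  rw [mul_div_assoc, abs_mul, abs_div, abs_mul, abs_of_nonneg (sq_nonneg (en ξ))]
  refine mul_le_of_le_one_right (abs_nonneg _) (div_le_one_of_le₀ ?_ (sq_nonneg _))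
  rw [sq]
  exact mul_le_mul (abs_le_en ξ n) (abs_le_en ξ p) (abs_nonneg _) (en_nonneg ξ)

/-- The sum of the moduli of the components of a vector field, as a nonnegative function. -/
def absSum (U : V3 → Fin 3 → ℂ) (η : V3) : ℝ≥0∞ := ∑ k, ‖U η k‖ₑ

theorem enorm_Qhat_le (α : Coeffs) :
    ∃ C : ℝ≥0∞, C ≠ ⊤ ∧ ∀ (U : V3 → Fin 3 → ℂ) (ξ : V3) (j : Fin 3),
      ‖Qhat α U U ξ j‖ₑ ≤ C * (eE ξ * ∫⁻ η, absSum U η * absSum U (ξ - η)) := by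
  set a : ℝ≥0∞ := ENNReal.ofReal ((2 * Real.pi) ^ 3)⁻¹
  refine ⟨∑ j, ∑ k, ∑ l, ∑ m, ENNReal.ofReal (∑ n, ∑ p, |α j m n p k l|) * a,
    by simp [ENNReal.sum_eq_top, ENNReal.mul_eq_top, a], fun U ξ j => ?_⟩
  have hterm : ∀ k l m : Fin 3, ‖(qsym α j m k l ξ : ℂ) * (Complex.I * (ξ m : ℂ)) *
      ((((2 * Real.pi) ^ (3 : ℕ))⁻¹ : ℝ) : ℂ) * ∫ η : V3, U η k * U (ξ - η) l‖ₑ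
      ≤ ENNReal.ofReal (∑ n, ∑ p, |α j m n p k l|) * a *
        (eE ξ * ∫⁻ η, absSum U η * absSum U (ξ - η)) := by
    intro k l m
    have h1 : ‖(qsym α j m k l ξ : ℂ)‖ₑ ≤ ENNReal.ofReal (∑ n, ∑ p, |α j m n p k l|) := by
      rw [← ofReal_norm, Complex.norm_real]
      exact ENNReal.ofReal_le_ofReal (abs_qsym_le α j m k l ξ)
    have h2 : ‖Complex.I * (ξ m : ℂ)‖ₑ ≤ eE ξ := by
      rw [← ofReal_norm, norm_mul, Complex.norm_I, one_mul, Complex.norm_real]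
      exact ENNReal.ofReal_le_ofReal (abs_le_en ξ m)
    have h3 : ‖((((2 * Real.pi) ^ (3 : ℕ))⁻¹ : ℝ) : ℂ)‖ₑ = a := by
      rw [← ofReal_norm, Complex.norm_real, Real.norm_of_nonneg (by positivity)]
    have h4 : ‖∫ η : V3, U η k * U (ξ - η) l‖ₑ ≤ ∫⁻ η, absSum U η * absSum U (ξ - η) := by
      refine (enorm_integral_le_lintegral_enorm _).trans (lintegral_mono fun η => ?_)
      rw [enorm_mul]
      exact mul_le_mul' (Finset.single_le_sum (f := fun k => ‖U η k‖ₑ) (fun _ _ => zero_le)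
        (Finset.mem_univ k)) (Finset.single_le_sum (f := fun k => ‖U (ξ - η) k‖ₑ)
        (fun _ _ => zero_le) (Finset.mem_univ l))
    calc _ = ‖(qsym α j m k l ξ : ℂ)‖ₑ * ‖Complex.I * (ξ m : ℂ)‖ₑ *
          ‖((((2 * Real.pi) ^ (3 : ℕ))⁻¹ : ℝ) : ℂ)‖ₑ * ‖∫ η : V3, U η k * U (ξ - η) l‖ₑ := by
          simp only [enorm_mul]
      _ ≤ ENNReal.ofReal (∑ n, ∑ p, |α j m n p k l|) * eE ξ * a *
          ∫⁻ η, absSum U η * absSum U (ξ - η) := by rw [h3]; gcongr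
      _ = _ := by ring
  simp only [Finset.sum_mul]
  refine le_trans ?_ (Finset.single_le_sum (fun _ _ => zero_le) (Finset.mem_univ j))
  refine (enorm_sum_le _ _).trans (Finset.sum_le_sum fun k _ => ?_)
  refine (enorm_sum_le _ _).trans (Finset.sum_le_sum fun l _ => ?_)
  exact (enorm_sum_le _ _).trans (Finset.sum_le_sum fun m _ => hterm k l m)

theorem exp_neg_mul_sq_le {θ : ℝ} (hθ : 0 < θ) {x a : ℝ} (hx : 0 < x) (ha : 0 < a) :
    ENNReal.ofReal (Real.exp (-(x * a ^ 2)))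
      ≤ ENNReal.ofReal (θ ^ θ) * (ENNReal.ofReal x ^ (-θ) * ENNReal.ofReal a ^ (-(2 * θ))) := by
  rw [ENNReal.ofReal_rpow_of_pos hx, ENNReal.ofReal_rpow_of_pos ha,
    ← ENNReal.ofReal_mul (by positivity), ← ENNReal.ofReal_mul (by positivity)]
  refine ENNReal.ofReal_le_ofReal ?_
  have hy : 0 < x * a ^ 2 := by positivity
  have h1 : x ^ (-θ) * a ^ (-(2 * θ)) = ((x * a ^ 2) ^ θ)⁻¹ := by
    rw [← Real.rpow_neg hy.le, Real.mul_rpow hx.le (by positivity), ← Real.rpow_natCast,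
      ← Real.rpow_mul ha.le]
    congr 2; push_cast; ring
  have h2 : (x * a ^ 2) ^ θ ≤ θ ^ θ * Real.exp (x * a ^ 2) := by
    have h3 : x * a ^ 2 ≤ θ * Real.exp (x * a ^ 2 / θ) := by
      have := Real.add_one_le_exp (x * a ^ 2 / θ)
      calc x * a ^ 2 = θ * (x * a ^ 2 / θ) := by field_simp
        _ ≤ _ := by gcongr; linarith
    calc _ ≤ (θ * Real.exp (x * a ^ 2 / θ)) ^ θ := Real.rpow_le_rpow hy.le h3 hθ.le
      _ = _ := by
        rw [Real.mul_rpow hθ.le (Real.exp_pos _).le, ← Real.exp_mul, div_mul_cancel₀ _ hθ.ne']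
  rw [h1, Real.exp_neg, ← div_eq_mul_inv, inv_eq_one_div, div_le_div_iff₀ (Real.exp_pos _)
    (by positivity), one_mul]
  exact h2

theorem ofReal_wD_sq_mul_vnSq {ξ : V3} (hξ : ξ ≠ 0) (s : ℝ) (v : Fin 3 → ℂ) :
    ENNReal.ofReal (wD s ξ ^ 2 * vnSq v) = ∑ j, (eE ξ ^ s * ‖v j‖ₑ) ^ 2 := by
  have h := en_pos hξ
  rw [vnSq, Finset.mul_sum, ENNReal.ofReal_sum_of_nonneg fun _ _ => by positivity]
  refine Finset.sum_congr rfl fun j _ => ?_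
  rw [← mul_pow, wD, ENNReal.ofReal_pow (mul_nonneg (Real.rpow_nonneg h.le _) (norm_nonneg _)),
    ENNReal.ofReal_mul (Real.rpow_nonneg h.le _), ← ENNReal.ofReal_rpow_of_pos h, ofReal_norm]
  rfl

theorem lintegral_absSum_sq_le (σ : ℝ) (U : V3 → Fin 3 → ℂ) :
    ∫⁻ η, (eE η ^ σ * absSum U η) ^ 2 ≤ 3 * wnorm (wD σ) U ^ 2 := by
  rw [wnorm, ← ENNReal.rpow_mul_natCast]
  norm_num
  rw [← lintegral_const_mul' _ _ (by simp)]
  refine lintegral_mono_ae ?_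
  filter_upwards [ae_ne_zero] with η hη
  rw [ofReal_wD_sq_mul_vnSq hη, absSum, Finset.mul_sum]
  have := ENNReal.rpow_sum_le_const_mul_sum_rpow Finset.univ
    (fun j => eE η ^ σ * ‖U η j‖ₑ) one_le_two
  norm_num at this
  exact this

theorem measurable_absSum {U : ℝ → V3 → Fin 3 → ℂ} (hU : MeasVF U) :
    Measurable (Function.uncurry fun s => absSum (U s)) := by
  simp only [Function.uncurry_def, absSum]
  exact Finset.measurable_sum _ fun k _ => (hU k).enorm

/-- The weighted self-convolution of `absSum U`. -/
def weightedConv (β : ℝ) (U : V3 → Fin 3 → ℂ) (ξ : V3) : ℝ≥0∞ :=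
  eE ξ ^ β * ∫⁻ η, absSum U η * absSum U (ξ - η)

theorem measurable_weightedConv {U : ℝ → V3 → Fin 3 → ℂ} (hU : MeasVF U) (β : ℝ) :
    Measurable (Function.uncurry fun s => weightedConv β (U s)) := by
  have h := measurable_absSum hU
  refine ((measurable_eE.comp measurable_snd).pow_const β).mul ?_
  refine Measurable.lintegral_prod_right (f := fun (z : ℝ × V3) (η : V3) =>
    absSum (U z.1) η * absSum (U z.1) (z.2 - η)) ?_
  exact (h.comp ((measurable_fst.comp measurable_fst).prodMk measurable_snd)).mul
    (h.comp ((measurable_fst.comp measurable_fst).prodMk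
      ((measurable_snd.comp measurable_fst).sub measurable_snd)))

theorem enorm_Bhat_le (α : Coeffs) {θ β γ : ℝ} (hθ : 0 < θ) (hγ : γ + 1 = β + 2 * θ) :
    ∃ C : ℝ≥0∞, C ≠ ⊤ ∧ ∀ (T : ℝ) (U : ℝ → V3 → Fin 3 → ℂ), ∀ t ∈ Ioo 0 T, ∀ ξ : V3, ξ ≠ 0 →
      ∀ j, eE ξ ^ γ * ‖Bhat α U U t ξ j‖ₑ ≤ C * ∫⁻ s, rieszKernel θ (t - s) *
        (Ioo 0 T).indicator (fun s => weightedConv β (U s) ξ) s := by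
  obtain ⟨C, hC, hQ⟩ := enorm_Qhat_le α
  refine ⟨ENNReal.ofReal (θ ^ θ) * C, by finiteness, fun T U t ht ξ hξ j => ?_⟩
  have hE0 : eE ξ ≠ 0 := eE_ne_zero hξ
  have hEt : eE ξ ≠ ⊤ := eE_ne_top ξ
  have hB : ‖Bhat α U U t ξ j‖ₑ ≤ ∫⁻ s in Ioo 0 t,
      ENNReal.ofReal (Real.exp (-((t - s) * en ξ ^ 2))) * ‖Qhat α (U s) (U s) ξ j‖ₑ := by
    rw [Bhat, intervalIntegral.integral_of_le ht.1.le, ← setLIntegral_congr Ioo_ae_eq_Ioc.symm]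
    refine (enorm_integral_le_lintegral_enorm _).trans (le_of_eq ?_)
    refine lintegral_congr fun s => ?_
    rw [enorm_mul, ← ofReal_norm, Complex.norm_real, Real.norm_of_nonneg (Real.exp_pos _).le]
  calc _ ≤ eE ξ ^ γ * ∫⁻ s in Ioo 0 t,
        ENNReal.ofReal (Real.exp (-((t - s) * en ξ ^ 2))) * ‖Qhat α (U s) (U s) ξ j‖ₑ := by
        gcongr
    _ = ∫⁻ s in Ioo 0 t, eE ξ ^ γ *
        (ENNReal.ofReal (Real.exp (-((t - s) * en ξ ^ 2))) * ‖Qhat α (U s) (U s) ξ j‖ₑ) :=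
        (lintegral_const_mul' _ _ (ENNReal.rpow_ne_top_of_ne_zero hE0 hEt)).symm
    _ ≤ ∫⁻ s in Ioo 0 t, ENNReal.ofReal (θ ^ θ) * C * (rieszKernel θ (t - s) *
        (Ioo 0 T).indicator (fun s => weightedConv β (U s) ξ) s) := by
        refine setLIntegral_mono' measurableSet_Ioo fun s hs => ?_
        have hts : 0 < t - s := sub_pos.2 hs.2
        rw [indicator_of_mem (show s ∈ Ioo 0 T from ⟨hs.1, hs.2.trans ht.2⟩), rieszKernel,
          indicator_of_mem (by exact hts), weightedConv]
        have hpow : eE ξ ^ γ * (eE ξ ^ (-(2 * θ)) * eE ξ) = eE ξ ^ β := by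
          nth_rw 3 [← ENNReal.rpow_one (eE ξ)]
          rw [← ENNReal.rpow_add _ _ hE0 hEt, ← ENNReal.rpow_add _ _ hE0 hEt]
          congr 1; linarith
        calc _ ≤ eE ξ ^ γ * (ENNReal.ofReal (θ ^ θ) *
              (ENNReal.ofReal (t - s) ^ (-θ) * eE ξ ^ (-(2 * θ))) *
              (C * (eE ξ * ∫⁻ η, absSum (U s) η * absSum (U s) (ξ - η)))) := by
              gcongr
              · exact exp_neg_mul_sq_le hθ hts (en_pos hξ)
              · exact hQ (U s) ξ j
          _ = ENNReal.ofReal (θ ^ θ) * C * (ENNReal.ofReal (t - s) ^ (-θ) *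
              ((eE ξ ^ γ * (eE ξ ^ (-(2 * θ)) * eE ξ)) *
                ∫⁻ η, absSum (U s) η * absSum (U s) (ξ - η))) := by ring
          _ = _ := by rw [hpow]
    _ ≤ ∫⁻ s, ENNReal.ofReal (θ ^ θ) * C * (rieszKernel θ (t - s) *
        (Ioo 0 T).indicator (fun s => weightedConv β (U s) ξ) s) := setLIntegral_le_lintegral _ _
    _ = _ := lintegral_const_mul' _ _ (by finiteness)

/-- Time-pointwise bound of the Duhamel term by a fractional integral of `‖u‖²`. -/
theorem wnorm_Bhat_le (α : Coeffs) {θ σ γ : ℝ} (hθ : 0 < θ) (hσ : 1 / 2 < σ) (hσ' : σ < 3 / 2)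
    (hγ : γ + 1 = 2 * σ - 3 / 2 + 2 * θ) :
    ∃ C : ℝ≥0∞, C ≠ ⊤ ∧ ∀ (T : ℝ) (U : ℝ → V3 → Fin 3 → ℂ), MeasVF U → ∀ t ∈ Ioo 0 T,
      wnorm (wD γ) (Bhat α U U t) ≤ C * ∫⁻ s, rieszKernel θ (t - s) *
        (Ioo 0 T).indicator (fun s => wnorm (wD σ) (U s) ^ 2) s := by
  obtain ⟨A, hA, hB⟩ := enorm_Bhat_le α hθ hγ
  obtain ⟨D, hD, hconv⟩ := lintegral_selfConv_le hσ hσ'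
  set M : ℝ≥0∞ := (3 * A ^ 2) ^ (1 / 2 : ℝ) with hM
  set K : ℝ≥0∞ := (D * 9) ^ (1 / 2 : ℝ) with hK
  have half_sq : ∀ x : ℝ≥0∞, (x ^ 2) ^ (1 / 2 : ℝ) = x := fun x => by
    rw [← ENNReal.rpow_natCast_mul]; norm_num
  refine ⟨M * K, by rw [hM, hK]; finiteness, fun T U hU t ht => ?_⟩
  set F : ℝ → V3 → ℝ≥0∞ := fun s ξ => rieszKernel θ (t - s) *
    (Ioo 0 T).indicator (fun s => weightedConv (2 * σ - 3 / 2) (U s) ξ) s with hF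
  have hFm : Measurable (Function.uncurry F) := by
    refine ((measurable_rieszKernel θ).comp (measurable_const.sub measurable_fst)).mul ?_
    exact Measurable.ite (p := fun z : ℝ × V3 => z.1 ∈ Ioo 0 T)
      (measurable_fst measurableSet_Ioo) (measurable_weightedConv hU _) measurable_const
  have hslice : ∀ s, (∫⁻ ξ, F s ξ ^ 2) ^ (1 / 2 : ℝ) ≤ K * (rieszKernel θ (t - s) *
      (Ioo 0 T).indicator (fun s => wnorm (wD σ) (U s) ^ 2) s) := by
    intro s
    by_cases hs : s ∈ Ioo 0 T
    · simp only [hF, indicator_of_mem hs, mul_pow]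
      have hm : Measurable (absSum (U s)) := (measurable_absSum hU).of_uncurry_left
      have hmw : Measurable (weightedConv (2 * σ - 3 / 2) (U s)) :=
        (measurable_weightedConv hU _).of_uncurry_left
      rw [lintegral_const_mul _ (hmw.pow_const 2),
        ENNReal.mul_rpow_of_nonneg _ _ (by norm_num), half_sq, mul_left_comm]
      gcongr
      calc _ ≤ (D * (∫⁻ η, (eE η ^ σ * absSum (U s) η) ^ 2) ^ 2) ^ (1 / 2 : ℝ) := by
            gcongr; exact hconv _ hm
        _ ≤ (D * (3 * wnorm (wD σ) (U s) ^ 2) ^ 2) ^ (1 / 2 : ℝ) := by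
            gcongr; exact lintegral_absSum_sq_le σ (U s)
        _ = (D * 9 * (wnorm (wD σ) (U s) ^ 2) ^ 2) ^ (1 / 2 : ℝ) := by
            rw [mul_pow, mul_assoc]; norm_num
        _ = _ := by rw [ENNReal.mul_rpow_of_nonneg _ _ (by norm_num), half_sq]
    · simp [hF, indicator_of_notMem hs]
  calc wnorm (wD γ) (Bhat α U U t)
      ≤ (∫⁻ ξ, 3 * A ^ 2 * (∫⁻ s, F s ξ) ^ 2) ^ (1 / 2 : ℝ) := by
        rw [wnorm]
        gcongr ?_ ^ _
        refine lintegral_mono_ae ?_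
        filter_upwards [ae_ne_zero] with ξ hξ
        rw [ofReal_wD_sq_mul_vnSq hξ]
        calc _ ≤ ∑ _j : Fin 3, (A * ∫⁻ s, F s ξ) ^ 2 :=
              Finset.sum_le_sum fun j _ => pow_le_pow_left' (hB T U t ht ξ hξ j) 2
          _ = _ := by simp [mul_pow, mul_assoc]
    _ = M * (∫⁻ ξ, (∫⁻ s, F s ξ) ^ 2) ^ (1 / 2 : ℝ) := by
        rw [lintegral_const_mul' _ _ (by finiteness), ENNReal.mul_rpow_of_nonneg _ _ (by norm_num)]
    _ ≤ M * ∫⁻ s, (∫⁻ ξ, F s ξ ^ 2) ^ (1 / 2 : ℝ) := by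
        gcongr
        exact (ENNReal.rpow_le_rpow (sq_lintegral_lintegral_le hFm)
          (by norm_num : (0 : ℝ) ≤ 1 / 2)).trans_eq (half_sq _)
    _ ≤ M * ∫⁻ s, K * (rieszKernel θ (t - s) *
          (Ioo 0 T).indicator (fun s => wnorm (wD σ) (U s) ^ 2) s) := by
        gcongr with s; exact hslice s
    _ = _ := by
        rw [lintegral_const_mul' _ _ (by rw [hK]; finiteness), mul_assoc]

theorem measurable_wnorm {U : ℝ → V3 → Fin 3 → ℂ} (hU : MeasVF U) (σ : ℝ) :
    Measurable fun s => wnorm (wD σ) (U s) := by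
  refine Measurable.pow_const ?_ _
  refine Measurable.lintegral_prod_right (f := fun (s : ℝ) (ξ : V3) =>
    ENNReal.ofReal (wD σ ξ ^ 2 * vnSq (U s ξ))) ?_
  have h1 : Measurable (wD σ) := measurable_en.pow_const σ
  have h2 : Measurable fun z : ℝ × V3 => vnSq (U z.1 z.2) :=
    Finset.measurable_sum _ fun j _ => (hU j).norm.pow_const 2
  exact (((h1.comp measurable_snd).pow_const 2).mul h2).ennreal_ofReal

/-- Hardy–Littlewood–Sobolev type space-time estimate for the
Duhamel term. -/
theorem statement19 (α : Coeffs) (q p : ℝ) (hq : 2 < q) (hp1 : 1 < p) (hpq : q / 2 < p) :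
    ∃ C > (0 : ℝ), ∀ T : ℝ, 0 < T → ∀ Uu : ℝ → V3 → Fin 3 → ℂ, MeasVF Uu →
      (∫⁻ s in Ioo (0 : ℝ) T, wnorm (wD (1 / 2 + 2 / q)) (Uu s) ^ q) < ⊤ →
      (∫⁻ t in Ioo (0 : ℝ) T, wnorm (wD (1 / 2 + 2 / p)) (Bhat α Uu Uu t) ^ p) ^ (1 / p)
        ≤ ENNReal.ofReal C *
          (∫⁻ s in Ioo (0 : ℝ) T, wnorm (wD (1 / 2 + 2 / q)) (Uu s) ^ q) ^ (2 / q) := by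
  have hq0 : 0 < q := by linarith
  have hp0 : 0 < p := by linarith
  have hq1 : 2 / q < 1 := (div_lt_one hq0).2 hq
  have hθ : 0 < 1 - (1 / (q / 2) - 1 / p) := by
    have : 0 < 1 / p := by positivity
    rw [one_div_div]; linarith
  obtain ⟨A, hA, hB⟩ := wnorm_Bhat_le α (γ := 1 / 2 + 2 / p) (σ := 1 / 2 + 2 / q) hθ
    (by have : 0 < 2 / q := by positivity
        linarith) (by linarith) (by rw [one_div_div]; ring)
  obtain ⟨D, hD, hI⟩ := hls (r := q / 2) (p := p) (by linarith) hpq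
  refine ⟨(A * D ^ (1 / p)).toReal + 1, by positivity, fun T _ U hU hfin => ?_⟩
  set σ := 1 / 2 + 2 / q
  set N := ∫⁻ s in Ioo (0 : ℝ) T, wnorm (wD σ) (U s) ^ q with hN
  set g : ℝ → ℝ≥0∞ := (Ioo 0 T).indicator fun s => wnorm (wD σ) (U s) ^ 2 with hg
  have hgm : Measurable g := ((measurable_wnorm hU σ).pow_const 2).indicator measurableSet_Ioo
  have hgN : ∫⁻ s, g s ^ (q / 2) = N := by
    rw [hN, ← lintegral_indicator measurableSet_Ioo]
    refine lintegral_congr fun s => ?_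
    by_cases hs : s ∈ Ioo 0 T
    · rw [hg, indicator_of_mem hs, indicator_of_mem hs, ← ENNReal.rpow_natCast_mul]
      congr 1; push_cast; ring
    · rw [hg, indicator_of_notMem hs, indicator_of_notMem hs, ENNReal.zero_rpow_of_pos (by linarith)]
  have hct : A * D ^ (1 / p) ≠ ⊤ := by
    have : 0 ≤ 1 / p := by positivity
    exact ENNReal.mul_ne_top hA (ENNReal.rpow_ne_top_of_nonneg this hD)
  calc _ ≤ (∫⁻ t, (A * ∫⁻ s, rieszKernel (1 - (1 / (q / 2) - 1 / p)) (t - s) * g s) ^ p)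
        ^ (1 / p) := by
        gcongr ?_ ^ _
        refine (setLIntegral_mono' measurableSet_Ioo fun t ht => ?_).trans
          (setLIntegral_le_lintegral (Ioo 0 T) _)
        exact ENNReal.rpow_le_rpow (hB T U hU t ht) hp0.le
    _ = (A ^ p * ∫⁻ t, (∫⁻ s, rieszKernel (1 - (1 / (q / 2) - 1 / p)) (t - s) * g s) ^ p)
        ^ (1 / p) := by
        simp_rw [ENNReal.mul_rpow_of_nonneg _ _ hp0.le]
        rw [lintegral_const_mul' _ _ (ENNReal.rpow_ne_top_of_nonneg hp0.le hA)]
    _ ≤ (A ^ p * (D * N ^ (p / (q / 2)))) ^ (1 / p) := by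
        have := hI g hgm (by rw [hgN]; exact hfin.ne)
        rw [hgN] at this
        gcongr
    _ = A * D ^ (1 / p) * N ^ (2 / q) := by
        have h1p : 0 ≤ 1 / p := by positivity
        rw [ENNReal.mul_rpow_of_nonneg _ _ h1p, ENNReal.mul_rpow_of_nonneg _ _ h1p,
          ← ENNReal.rpow_mul, ← ENNReal.rpow_mul, mul_one_div_cancel hp0.ne', ENNReal.rpow_one,
          mul_assoc]
        have : p / (q / 2) * (1 / p) = 2 / q := by field_simp
        rw [this]
    _ ≤ _ := by
        gcongr
        rw [← ENNReal.ofReal_toReal hct]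
        exact ENNReal.ofReal_le_ofReal (by simp)
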